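/- If C : X ⇉ Y is a multivalued map that is ε-simplicial from a filtered simplicial complex S to a filtered simplicial complex T, then any two single-valued maps f₁, f₂ : X → Y subordinate to C induce, for each parameter a, contiguous simplicial maps S_a → T_{a+ε}, and hence induce the same map on homology H(S_a) → H(T_{a+ε}). -/

import Mathlib

/-- The simplicial boundary operator on formal `𝕜`-linear combinations of
`(n+1)`-tuples of vertices of `X`. -/
noncomputable def bdry (𝕜 : Type*) [Field 𝕜] (X : Type*) (n : ℕ) :
    ((Fin (n + 1) → X) →₀ 𝕜) →ₗ[𝕜] ((Fin n → X) →₀ 𝕜) :=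
  Finsupp.lift ((Fin n → X) →₀ 𝕜) 𝕜 (Fin (n + 1) → X) fun σ =>
    ∑ i : Fin (n + 1), ((-1 : 𝕜) ^ (i : ℕ)) • Finsupp.single (σ ∘ i.succAbove) 1

/-- The subspace of chains supported on tuples satisfying `K` (the simplices of
a simplicial complex, given as a predicate on tuples of vertices). -/
noncomputable def chainsIn (𝕜 : Type*) [Field 𝕜] {X : Type*} (n : ℕ)
    (K : (Fin n → X) → Prop) : Submodule 𝕜 ((Fin n → X) →₀ 𝕜) :=
  Submodule.span 𝕜 {c | ∃ σ, K σ ∧ c = Finsupp.single σ (1 : 𝕜)}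

/-- The chain map induced by a vertex map `f : X → Y`. -/
noncomputable def pushChain (𝕜 : Type*) [Field 𝕜] {X Y : Type*} (n : ℕ) (f : X → Y) :
    ((Fin n → X) →₀ 𝕜) →ₗ[𝕜] ((Fin n → Y) →₀ 𝕜) :=
  Finsupp.lmapDomain 𝕜 𝕜 fun σ : Fin n → X => f ∘ σ

/-- The image of a set under a multivalued map (relation) `C : X ⇉ Y`. -/
def mvImage {X Y : Type*} (C : Set (X × Y)) (s : Set X) : Set Y :=
  {y | ∃ x ∈ s, (x, y) ∈ C}

/-- A tuple of vertices spans a simplex of the complex `K` (given as a set of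
finite vertex sets). -/
def tupleIn {X : Type*} [DecidableEq X] (K : Set (Finset X)) {n : ℕ}
    (σ : Fin n → X) : Prop :=
  Finset.image σ Finset.univ ∈ K

/-- `C` is ε-simplicial from the filtered complex `S` to the filtered complex `T`:
for every `a` and every simplex `σ ∈ S a`, every finite subset of `C(σ)` is a
simplex of `T (a + ε)`. -/
def EpsSimplicial {X Y : Type*} (C : Set (X × Y)) (S : ℝ → Set (Finset X))
    (T : ℝ → Set (Finset Y)) (ε : ℝ) : Prop :=
  ∀ a : ℝ, ∀ σ ∈ S a, ∀ τ : Finset Y, ↑τ ⊆ mvImage C ↑σ → τ ∈ T (a + ε)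

open Finsupp in
theorem bdry_single {𝕜 : Type*} [Field 𝕜] {X : Type*} {n : ℕ} (σ : Fin (n + 1) → X) :
    bdry 𝕜 X n (single σ 1) =
      ∑ i : Fin (n + 1), ((-1 : 𝕜) ^ (i : ℕ)) • single (σ ∘ i.succAbove) 1 := by
  simp [bdry]

open Finsupp in
theorem pushChain_single {𝕜 : Type*} [Field 𝕜] {X Y : Type*} {n : ℕ} (f : X → Y)
    (σ : Fin n → X) : pushChain 𝕜 n f (single σ 1) = single (f ∘ σ) 1 := by
  simp [pushChain]

/-- The cone operator on chains, prepending the vertex `v` to every tuple. -/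
noncomputable def coneChain (𝕜 : Type*) [Field 𝕜] {X : Type*} {n : ℕ} (v : X) :
    ((Fin n → X) →₀ 𝕜) →ₗ[𝕜] ((Fin (n + 1) → X) →₀ 𝕜) :=
  Finsupp.lmapDomain 𝕜 𝕜 fun σ => Fin.cons v σ

open Finsupp in
theorem coneChain_single {𝕜 : Type*} [Field 𝕜] {X : Type*} {n : ℕ} (v : X)
    (σ : Fin n → X) :
    coneChain 𝕜 v (single σ 1) = single (Fin.cons v σ : Fin (n + 1) → X) 1 := by
  simp [coneChain]

/-- Linear maps on chains agree if they agree on single tuples. -/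
theorem chain_hom_ext {𝕜 : Type*} [Field 𝕜] {X M : Type*} [AddCommGroup M] [Module 𝕜 M]
    {n : ℕ} {φ ψ : ((Fin n → X) →₀ 𝕜) →ₗ[𝕜] M}
    (h : ∀ σ, φ (Finsupp.single σ 1) = ψ (Finsupp.single σ 1)) (c : (Fin n → X) →₀ 𝕜) :
    φ c = ψ c := by
  have : φ = ψ := by
    ext σ
    simpa using h σ
  rw [this]

theorem bdry_zero_coneChain {𝕜 : Type*} [Field 𝕜] {X : Type*} (v : X)
    (c : (Fin 0 → X) →₀ 𝕜) : bdry 𝕜 X 0 (coneChain 𝕜 v c) = c := by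
  refine chain_hom_ext (φ := bdry 𝕜 X 0 ∘ₗ coneChain 𝕜 v) (ψ := LinearMap.id)
    (fun σ => ?_) c
  simp only [LinearMap.comp_apply, LinearMap.id_apply, coneChain_single, bdry_single]
  simp only [Nat.reduceAdd, Finset.univ_unique, Finset.sum_singleton, Fin.default_eq_zero,
    Fin.val_zero, pow_zero, one_smul]
  congr 1

theorem bdry_succ_coneChain {𝕜 : Type*} [Field 𝕜] {X : Type*} {n : ℕ} (v : X)
    (c : (Fin (n + 1) → X) →₀ 𝕜) :
    bdry 𝕜 X (n + 1) (coneChain 𝕜 v c) = c - coneChain 𝕜 v (bdry 𝕜 X n c) := by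
  refine chain_hom_ext (φ := bdry 𝕜 X (n + 1) ∘ₗ coneChain 𝕜 v)
    (ψ := LinearMap.id - coneChain 𝕜 v ∘ₗ bdry 𝕜 X n) (fun σ => ?_) c
  have face_zero : (Fin.cons v σ : Fin (n + 2) → X) ∘ Fin.succAbove 0 = σ := by
    ext j
    simp
  have face_succ (i : Fin (n + 1)) :
      (Fin.cons v σ : Fin (n + 2) → X) ∘ i.succ.succAbove =
        Fin.cons v (σ ∘ i.succAbove) := by
    ext j
    cases j using Fin.cases <;> simp
  simp only [LinearMap.comp_apply, LinearMap.sub_apply, LinearMap.id_apply, coneChain_single,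
    bdry_single, map_sum, map_smul]
  rw [Fin.sum_univ_succ, face_zero]
  simp only [face_succ, Fin.val_zero, Fin.val_succ, pow_zero, one_smul, pow_succ, mul_neg,
    mul_one, neg_smul, Finset.sum_neg_distrib, sub_eq_add_neg]

theorem pushChain_coneChain {𝕜 : Type*} [Field 𝕜] {X Y : Type*} {n : ℕ} (f : X → Y) (v : X)
    (c : (Fin n → X) →₀ 𝕜) :
    pushChain 𝕜 (n + 1) f (coneChain 𝕜 v c) = coneChain 𝕜 (f v) (pushChain 𝕜 n f c) := by
  refine chain_hom_ext (φ := pushChain 𝕜 (n + 1) f ∘ₗ coneChain 𝕜 v)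
    (ψ := coneChain 𝕜 (f v) ∘ₗ pushChain 𝕜 n f) (fun σ => ?_) c
  simp only [LinearMap.comp_apply, coneChain_single, pushChain_single]
  congr 1
  ext j
  cases j using Fin.cases <;> simp

theorem bdry_pushChain {𝕜 : Type*} [Field 𝕜] {X Y : Type*} {n : ℕ} (f : X → Y)
    (c : (Fin (n + 1) → X) →₀ 𝕜) :
    bdry 𝕜 Y n (pushChain 𝕜 (n + 1) f c) = pushChain 𝕜 n f (bdry 𝕜 X n c) := by
  refine chain_hom_ext (φ := bdry 𝕜 Y n ∘ₗ pushChain 𝕜 (n + 1) f)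
    (ψ := pushChain 𝕜 n f ∘ₗ bdry 𝕜 X n) (fun σ => ?_) c
  simp only [LinearMap.comp_apply, pushChain_single, bdry_single, map_sum, map_smul,
    Function.comp_assoc]

/-- The prism operator, a chain homotopy between the chain maps induced by `f` and `g`. -/
noncomputable def prismChain (𝕜 : Type*) [Field 𝕜] {X Y : Type*} (f g : X → Y) :
    ∀ n : ℕ, ((Fin n → X) →₀ 𝕜) →ₗ[𝕜] ((Fin (n + 1) → Y) →₀ 𝕜)
  | 0 => 0
  | n + 1 => Finsupp.lift ((Fin (n + 2) → Y) →₀ 𝕜) 𝕜 (Fin (n + 1) → X) fun σ =>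
      coneChain 𝕜 (f (σ 0)) (coneChain 𝕜 (g (σ 0))
          (pushChain 𝕜 n g (Finsupp.single (Fin.tail σ) 1))) -
        coneChain 𝕜 (f (σ 0)) (prismChain 𝕜 f g n (Finsupp.single (Fin.tail σ) 1))

theorem prismChain_coneChain {𝕜 : Type*} [Field 𝕜] {X Y : Type*} (f g : X → Y) {n : ℕ} (v : X)
    (c : (Fin n → X) →₀ 𝕜) :
    prismChain 𝕜 f g (n + 1) (coneChain 𝕜 v c) =
      coneChain 𝕜 (f v) (coneChain 𝕜 (g v) (pushChain 𝕜 n g c)) -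
        coneChain 𝕜 (f v) (prismChain 𝕜 f g n c) := by
  refine chain_hom_ext (φ := prismChain 𝕜 f g (n + 1) ∘ₗ coneChain 𝕜 v)
    (ψ := coneChain 𝕜 (f v) ∘ₗ coneChain 𝕜 (g v) ∘ₗ pushChain 𝕜 n g -
      coneChain 𝕜 (f v) ∘ₗ prismChain 𝕜 f g n) (fun σ => ?_) c
  simp [coneChain_single, prismChain]

theorem single_eq_coneChain {𝕜 : Type*} [Field 𝕜] {X : Type*} {n : ℕ} (σ : Fin (n + 1) → X) :
    Finsupp.single σ (1 : 𝕜) = coneChain 𝕜 (σ 0) (Finsupp.single (Fin.tail σ) 1) := by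
  rw [coneChain_single, Fin.cons_self_tail]

theorem bdry_prismChain {𝕜 : Type*} [Field 𝕜] {X Y : Type*} (f g : X → Y) {n : ℕ}
    (c : (Fin (n + 1) → X) →₀ 𝕜) :
    bdry 𝕜 Y (n + 1) (prismChain 𝕜 f g (n + 1) c) =
      pushChain 𝕜 (n + 1) g c - pushChain 𝕜 (n + 1) f c -
        prismChain 𝕜 f g n (bdry 𝕜 X n c) := by
  induction n with
  | zero =>
    refine chain_hom_ext (φ := bdry 𝕜 Y 1 ∘ₗ prismChain 𝕜 f g 1)
      (ψ := pushChain 𝕜 1 g - pushChain 𝕜 1 f - prismChain 𝕜 f g 0 ∘ₗ bdry 𝕜 X 0)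
      (fun σ => ?_) c
    have push_eq : pushChain 𝕜 0 f (Finsupp.single (Fin.tail σ) 1) =
        pushChain 𝕜 0 g (Finsupp.single (Fin.tail σ) 1) := by
      rw [pushChain_single, pushChain_single, Subsingleton.elim (f ∘ Fin.tail σ)]
    have prism_zero : prismChain 𝕜 f g 0 = 0 := rfl
    simp only [LinearMap.comp_apply, LinearMap.sub_apply, single_eq_coneChain σ,
      prismChain_coneChain, pushChain_coneChain, prism_zero, LinearMap.zero_apply, map_zero,
      sub_zero, bdry_succ_coneChain, bdry_zero_coneChain, push_eq]
  | succ n ih =>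
    refine chain_hom_ext (φ := bdry 𝕜 Y (n + 2) ∘ₗ prismChain 𝕜 f g (n + 2))
      (ψ := pushChain 𝕜 (n + 2) g - pushChain 𝕜 (n + 2) f -
        prismChain 𝕜 f g (n + 1) ∘ₗ bdry 𝕜 X (n + 1)) (fun σ => ?_) c
    simp only [LinearMap.comp_apply, LinearMap.sub_apply, single_eq_coneChain σ,
      prismChain_coneChain, pushChain_coneChain, bdry_succ_coneChain, bdry_pushChain, ih, map_sub]
    abel

theorem single_mem_chainsIn {𝕜 : Type*} [Field 𝕜] {X : Type*} {n : ℕ}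
    {K : (Fin n → X) → Prop} {σ : Fin n → X} (h : K σ) :
    Finsupp.single σ (1 : 𝕜) ∈ chainsIn 𝕜 n K :=
  Submodule.subset_span ⟨σ, h, rfl⟩

theorem chainsIn_mono {𝕜 : Type*} [Field 𝕜] {X : Type*} {n : ℕ} {K L : (Fin n → X) → Prop}
    (h : ∀ σ, K σ → L σ) : chainsIn 𝕜 n K ≤ chainsIn 𝕜 n L :=
  Submodule.span_mono fun _ ⟨σ, hσ, hc⟩ => ⟨σ, h σ hσ, hc⟩

theorem map_mem_of_mem_chainsIn {𝕜 : Type*} [Field 𝕜] {X M : Type*} [AddCommGroup M] [Module 𝕜 M]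
    {n : ℕ} {K : (Fin n → X) → Prop} {φ : ((Fin n → X) →₀ 𝕜) →ₗ[𝕜] M} {N : Submodule 𝕜 M}
    (h : ∀ σ, K σ → φ (Finsupp.single σ 1) ∈ N) {c : (Fin n → X) →₀ 𝕜}
    (hc : c ∈ chainsIn 𝕜 n K) : φ c ∈ N := by
  have hle : chainsIn 𝕜 n K ≤ N.comap φ := by
    refine Submodule.span_le.2 ?_
    rintro _ ⟨σ, hσ, rfl⟩
    exact h σ hσ
  exact hle hc

theorem coneChain_mem_chainsIn {𝕜 : Type*} [Field 𝕜] {X : Type*} {n : ℕ} {s : Set X} {v : X}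
    (hv : v ∈ s) {c : (Fin n → X) →₀ 𝕜} (hc : c ∈ chainsIn 𝕜 n fun τ => ∀ i, τ i ∈ s) :
    coneChain 𝕜 v c ∈ chainsIn 𝕜 (n + 1) fun τ => ∀ i, τ i ∈ s := by
  refine map_mem_of_mem_chainsIn (fun τ hτ => ?_) hc
  rw [coneChain_single]
  exact single_mem_chainsIn (Fin.cases hv hτ)

theorem prismChain_single_mem_chainsIn {𝕜 : Type*} [Field 𝕜] {X Y : Type*} {f g : X → Y} {n : ℕ}
    {s : Set Y} {σ : Fin n → X} (hf : ∀ i, f (σ i) ∈ s) (hg : ∀ i, g (σ i) ∈ s) :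
    prismChain 𝕜 f g n (Finsupp.single σ 1) ∈ chainsIn 𝕜 (n + 1) fun τ => ∀ i, τ i ∈ s := by
  induction n with
  | zero => exact Submodule.zero_mem _
  | succ n ih =>
    rw [single_eq_coneChain, prismChain_coneChain, pushChain_single]
    exact Submodule.sub_mem _
      (coneChain_mem_chainsIn (hf 0) (coneChain_mem_chainsIn (hg 0)
        (single_mem_chainsIn fun i => hg i.succ)))
      (coneChain_mem_chainsIn (hf 0) (ih (fun i => hf i.succ) fun i => hg i.succ))

theorem stmt0 (𝕜 : Type*) [Field 𝕜] {X Y : Type*} [DecidableEq X] [DecidableEq Y]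
    (S : ℝ → Set (Finset X)) (T : ℝ → Set (Finset Y))
    (C : Set (X × Y)) (hC : ∀ x : X, ∃ y : Y, (x, y) ∈ C) (ε : ℝ)
    (hsimp : EpsSimplicial C S T ε)
    (f₁ f₂ : X → Y) (hf₁ : ∀ x, (x, f₁ x) ∈ C) (hf₂ : ∀ x, (x, f₂ x) ∈ C) :
    -- f₁ and f₂ induce simplicial maps S_a → T_{a+ε} which are contiguous
    (∀ a : ℝ, ∀ σ ∈ S a,
      Finset.image f₁ σ ∈ T (a + ε) ∧ Finset.image f₂ σ ∈ T (a + ε) ∧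
        Finset.image f₁ σ ∪ Finset.image f₂ σ ∈ T (a + ε)) ∧
    -- hence they induce the same map H(S_a) → H(T_{a+ε}): on every cycle of S_a the
    -- two induced chains differ by a boundary in T_{a+ε}
    ∀ (a : ℝ) (n : ℕ) (z : (Fin (n + 1) → X) →₀ 𝕜),
      z ∈ chainsIn 𝕜 (n + 1) (tupleIn (S a)) → bdry 𝕜 X n z = 0 →
        ∃ w ∈ chainsIn 𝕜 (n + 2) (tupleIn (T (a + ε))),
          pushChain 𝕜 (n + 1) f₁ z - pushChain 𝕜 (n + 1) f₂ z = bdry 𝕜 Y (n + 1) w := by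
  have image_subset {f : X → Y} (hf : ∀ x, (x, f x) ∈ C) (σ : Finset X) :
      (↑(Finset.image f σ) : Set Y) ⊆ mvImage C ↑σ := by
    intro y hy
    obtain ⟨x, hx, rfl⟩ := Finset.mem_image.1 (Finset.mem_coe.1 hy)
    exact ⟨x, hx, hf x⟩
  refine ⟨fun a σ hσ => ⟨hsimp a σ hσ _ (image_subset hf₁ σ), hsimp a σ hσ _ (image_subset hf₂ σ),
    hsimp a σ hσ _ ?_⟩, fun a n z hz hbdry => ⟨prismChain 𝕜 f₂ f₁ (n + 1) z, ?_, ?_⟩⟩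
  · rw [Finset.coe_union]
    exact Set.union_subset (image_subset hf₁ σ) (image_subset hf₂ σ)
  · refine map_mem_of_mem_chainsIn (fun σ hσ => ?_) hz
    have vertex_mem (i : Fin (n + 1)) :
        σ i ∈ (↑(Finset.image σ Finset.univ) : Set X) := by simp
    refine chainsIn_mono (fun τ hτ => ?_)
      (prismChain_single_mem_chainsIn
        (s := mvImage C ↑(Finset.image σ Finset.univ))
        (fun i => ⟨σ i, vertex_mem i, hf₂ _⟩) (fun i => ⟨σ i, vertex_mem i, hf₁ _⟩))
    refine hsimp a _ hσ _ fun y hy => ?_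
    obtain ⟨i, -, rfl⟩ := Finset.mem_image.1 (Finset.mem_coe.1 hy)
    exact hτ i
  · rw [bdry_prismChain, hbdry, map_zero, sub_zero]
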